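/- arXiv:1809.00106 — 3 statements merged into one kernel-verified Lean document; each statement's English description precedes it below -/
import Mathlib

section
/- Let t₀ ∈ ℝ, δ > 0 and a, b > 0, A, B ≥ 0. Let Φ : ℝ → ℝ be continuous on [t₀, t₀+δ], differentiable on (t₀, t₀+δ) and nonnegative there, and let Ψ, F : ℝ → ℝ be nonnegative and continuous on [t₀, t₀+δ]. Assume that for all t ∈ (t₀, t₀+δ) one has Φ'(t) + a·Φ(t) + b·Ψ(t) ≤ F(t) + A·δ·∫_{t₀}^t Φ(s) ds + B·δ·∫_{t₀}^t Ψ(s) ds, and that δ·(e^{(a/2)δ} − 1)·A ≤ a²/4 and δ·(e^{(a/2)δ} − 1)·B ≤ a·b/4. Then for all t ∈ (t₀, t₀+δ]: Φ(t) + (b/2)·∫_{t₀}^t e^{-(a/2)(t−s)} Ψ(s) ds ≤ e^{-(a/2)(t−t₀)} Φ(t₀) + ∫_{t₀}^t e^{-(a/2)(t−s)} F(s) ds. -/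
open Set MeasureTheory intervalIntegral

/-- The fundamental theorem of calculus for a function continuous on a closed interval only. -/
theorem hasDerivAt_primitive_of_continuousOn_Icc {f : ℝ → ℝ} {u v t : ℝ}
    (hf : ContinuousOn f (Icc u v)) (ht : t ∈ Ioo u v) :
    HasDerivAt (fun x => ∫ s in u..x, f s) (f t) t := by
  refine integral_hasDerivAt_right ?_ ?_ (hf.continuousAt (Icc_mem_nhds ht.1 ht.2))
  · exact (hf.mono (Icc_subset_Icc_right ht.2.le)).intervalIntegrable_of_Icc ht.1.le
  · exact (hf.mono Ioo_subset_Icc_self).stronglyMeasurableAtFilter isOpen_Ioo t ht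

theorem continuousOn_primitive_of_continuousOn_Icc {f : ℝ → ℝ} {u v : ℝ} (huv : u ≤ v)
    (hf : ContinuousOn f (Icc u v)) :
    ContinuousOn (fun x => ∫ s in u..x, f s) (Icc u v) := by
  have h := continuousOn_primitive_interval (μ := volume) (f := f) (a := u) (b := v)
    (by rw [uIcc_of_le huv]; exact hf.integrableOn_Icc)
  rwa [uIcc_of_le huv] at h

theorem continuousOn_exp_weight_mul {f : ℝ → ℝ} {S : Set ℝ} (c u : ℝ) (hf : ContinuousOn f S) :
    ContinuousOn (fun s => Real.exp (c * (s - u)) * f s) S :=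
  ContinuousOn.mul (by fun_prop) hf

/-- On an interval of length at most `δ`, moving the weight `exp (c * (· - u))` inside the
integral of a nonnegative function costs at most a factor `exp (c * δ)`. -/
theorem exp_weight_mul_integral_le {f : ℝ → ℝ} {c δ u t : ℝ} (hc : 0 ≤ c) (hut : u ≤ t)
    (ht : t ≤ u + δ) (hf : ContinuousOn f (Icc u t)) (hf0 : ∀ s ∈ Ioo u t, 0 ≤ f s) :
    Real.exp (c * (t - u)) * (∫ s in u..t, f s) ≤
      Real.exp (c * δ) * ∫ s in u..t, Real.exp (c * (s - u)) * f s := by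
  rw [← intervalIntegral.integral_const_mul, ← intervalIntegral.integral_const_mul]
  refine integral_mono_on_of_le_Ioo hut ?_ ?_ fun s hs => ?_
  · exact (hf.const_mul _).intervalIntegrable_of_Icc hut
  · exact ((continuousOn_exp_weight_mul c u hf).const_mul _).intervalIntegrable_of_Icc hut
  · rw [← mul_assoc, ← Real.exp_add]
    refine mul_le_mul_of_nonneg_right (Real.exp_le_exp.2 ?_) (hf0 s hs)
    nlinarith [mul_nonneg hc (by linarith [hs.1] : 0 ≤ δ + s - t)]

theorem exp_weight_mul_integral_exp_neg (f : ℝ → ℝ) (c u t : ℝ) :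
    Real.exp (c * (t - u)) * (∫ s in u..t, Real.exp (-c * (t - s)) * f s) =
      ∫ s in u..t, Real.exp (c * (s - u)) * f s := by
  rw [← intervalIntegral.integral_const_mul]
  congr 1 with s
  rw [← mul_assoc, ← Real.exp_add]
  ring_nf

/-- Non-local Gronwall inequality, part (i): under a differential inequality with
non-local (time-integrated) terms of size `δ`, and smallness conditions on `δ`,
one obtains exponential decay with the dissipation partially retained. -/
theorem nonlocal_gronwall_part_i
    (t₀ δ a b A B : ℝ) (hδ : 0 < δ) (ha : 0 < a) (hb : 0 < b)
    (hA : 0 ≤ A) (hB : 0 ≤ B)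
    (Φ Φ' Ψ F : ℝ → ℝ)
    (hΦc : ContinuousOn Φ (Icc t₀ (t₀ + δ)))
    (hΦd : ∀ t ∈ Ioo t₀ (t₀ + δ), HasDerivAt Φ (Φ' t) t)
    (hΦnn : ∀ t ∈ Ioo t₀ (t₀ + δ), 0 ≤ Φ t)
    (hΨc : ContinuousOn Ψ (Icc t₀ (t₀ + δ)))
    (hΨnn : ∀ t ∈ Icc t₀ (t₀ + δ), 0 ≤ Ψ t)
    (hFc : ContinuousOn F (Icc t₀ (t₀ + δ)))
    (hFnn : ∀ t ∈ Icc t₀ (t₀ + δ), 0 ≤ F t)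
    (hineq : ∀ t ∈ Ioo t₀ (t₀ + δ),
      Φ' t + a * Φ t + b * Ψ t ≤
        F t + A * δ * (∫ s in t₀..t, Φ s) + B * δ * (∫ s in t₀..t, Ψ s))
    (hδA : δ * (Real.exp ((a / 2) * δ) - 1) * A ≤ a ^ 2 / 4)
    (hδB : δ * (Real.exp ((a / 2) * δ) - 1) * B ≤ a * b / 4) :
    ∀ t ∈ Ioc t₀ (t₀ + δ),
      Φ t + (b / 2) * (∫ s in t₀..t, Real.exp (-(a / 2) * (t - s)) * Ψ s) ≤
        Real.exp (-(a / 2) * (t - t₀)) * Φ t₀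
          + ∫ s in t₀..t, Real.exp (-(a / 2) * (t - s)) * F s := by
  intro t ht
  obtain ⟨c, rfl⟩ : ∃ c, a = 2 * c := ⟨a / 2, by ring⟩
  rw [mul_div_cancel_left₀ c two_ne_zero] at *
  have hc : 0 < c := by linarith
  have htδ : Icc t₀ t ⊆ Icc t₀ (t₀ + δ) := Icc_subset_Icc_right ht.2
  have hcont {f : ℝ → ℝ} (hf : ContinuousOn f (Icc t₀ (t₀ + δ))) :=
    continuousOn_primitive_of_continuousOn_Icc (by linarith) hf
  have hweight {f : ℝ → ℝ} (hf : ContinuousOn f (Icc t₀ (t₀ + δ))) :=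
    continuousOn_exp_weight_mul c t₀ hf
  let H : ℝ → ℝ := fun x =>
    Real.exp (c * (x - t₀)) * Φ x + c * (∫ s in t₀..x, Real.exp (c * (s - t₀)) * Φ s)
      + b * (∫ s in t₀..x, Real.exp (c * (s - t₀)) * Ψ s)
      - (∫ s in t₀..x, Real.exp (c * (s - t₀)) * F s)
      - A * δ / c * (Real.exp (c * (x - t₀)) * (∫ s in t₀..x, Φ s)
        - ∫ s in t₀..x, Real.exp (c * (s - t₀)) * Φ s)
      - B * δ / c * (Real.exp (c * (x - t₀)) * (∫ s in t₀..x, Ψ s)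
        - ∫ s in t₀..x, Real.exp (c * (s - t₀)) * Ψ s)
  have hHc : ContinuousOn H (Icc t₀ (t₀ + δ)) :=
    (((((hweight hΦc).add ((hcont (hweight hΦc)).const_mul c)).add
      ((hcont (hweight hΨc)).const_mul b)).sub (hcont (hweight hFc))).sub
      (((hweight (hcont hΦc)).sub (hcont (hweight hΦc))).const_mul _)).sub
      (((hweight (hcont hΨc)).sub (hcont (hweight hΨc))).const_mul _)
  have hHd : ∀ x ∈ Ioo t₀ (t₀ + δ), HasDerivAt H (Real.exp (c * (x - t₀)) *
      (Φ' x + 2 * c * Φ x + b * Ψ x -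
        (F x + A * δ * (∫ s in t₀..x, Φ s) + B * δ * (∫ s in t₀..x, Ψ s)))) x := by
    intro x hx
    have hE : HasDerivAt (fun y => Real.exp (c * (y - t₀)))
        (Real.exp (c * (x - t₀)) * (c * 1)) x :=
      (((hasDerivAt_id x).sub_const t₀).const_mul c).exp
    have hprim {f : ℝ → ℝ} (hf : ContinuousOn f (Icc t₀ (t₀ + δ))) :=
      hasDerivAt_primitive_of_continuousOn_Icc hf hx
    refine HasDerivAt.congr_deriv ((((((hE.mul (hΦd x hx)).add ((hprim (hweight hΦc)).const_mul c)).add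
      ((hprim (hweight hΨc)).const_mul b)).sub (hprim (hweight hFc))).sub
      (((hE.mul (hprim hΦc)).sub (hprim (hweight hΦc))).const_mul (A * δ / c))).sub
      (((hE.mul (hprim hΨc)).sub (hprim (hweight hΨc))).const_mul (B * δ / c))) ?_
    field_simp
    ring
  have hanti : AntitoneOn H (Icc t₀ (t₀ + δ)) := by
    refine antitoneOn_of_deriv_nonpos (convex_Icc _ _) hHc ?_ ?_ <;> rw [interior_Icc]
    · exact fun x hx => (hHd x hx).differentiableAt.differentiableWithinAt
    · intro x hx
      rw [(hHd x hx).deriv]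
      exact mul_nonpos_of_nonneg_of_nonpos (Real.exp_pos _).le (sub_nonpos.2 (hineq x hx))
  have hH : H t ≤ Φ t₀ := by
    simpa [H] using hanti (left_mem_Icc.2 (by linarith)) (Ioc_subset_Icc_self ht) ht.1.le
  have habsorb {f : ℝ → ℝ} {K k : ℝ} (hf : ContinuousOn f (Icc t₀ (t₀ + δ)))
      (hf0 : ∀ s ∈ Ioo t₀ (t₀ + δ), 0 ≤ f s) (hK : 0 ≤ K)
      (hk : δ * (Real.exp (c * δ) - 1) * K ≤ c * k) :
      K * δ / c * (Real.exp (c * (t - t₀)) * (∫ s in t₀..t, f s)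
        - ∫ s in t₀..t, Real.exp (c * (s - t₀)) * f s) ≤
        k * ∫ s in t₀..t, Real.exp (c * (s - t₀)) * f s := by
    have hf0' : ∀ s ∈ Ioo t₀ t, 0 ≤ f s := fun s hs => hf0 s ⟨hs.1, hs.2.trans_le ht.2⟩
    have hle := exp_weight_mul_integral_le hc.le ht.1.le ht.2 (hf.mono htδ) hf0'
    have hI : 0 ≤ ∫ s in t₀..t, Real.exp (c * (s - t₀)) * f s := by
      simpa using integral_mono_on_of_le_Ioo ht.1.le intervalIntegrable_const
        (((hweight hf).mono htδ).intervalIntegrable_of_Icc (μ := volume) ht.1.le)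
        fun s hs => mul_nonneg (Real.exp_pos _).le (hf0' s hs)
    set I := ∫ s in t₀..t, Real.exp (c * (s - t₀)) * f s
    calc _ ≤ K * δ / c * (Real.exp (c * δ) * I - I) := by gcongr
      _ = δ * (Real.exp (c * δ) - 1) * K / c * I := by ring
      _ ≤ k * I := by
        gcongr
        rwa [div_le_iff₀' hc]
  have hΦabs := habsorb (k := c) hΦc hΦnn hA (by linarith)
  have hΨabs := habsorb (k := b / 2) hΨc (fun s hs => hΨnn s (Ioo_subset_Icc_self hs)) hB
    (by linarith)
  have hE : Real.exp (c * (t - t₀)) * Real.exp (-c * (t - t₀)) = 1 := by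
    rw [← Real.exp_add]; simp
  refine le_of_mul_le_mul_left ?_ (Real.exp_pos (c * (t - t₀)))
  rw [mul_add, mul_add, mul_left_comm, exp_weight_mul_integral_exp_neg,
    exp_weight_mul_integral_exp_neg, ← mul_assoc, hE, one_mul]
  simp only [H] at hH
  linarith
end

section
/- Let t₀ ∈ ℝ, δ > 0 and a, b > 0, A, B ≥ 0. Let Φ : ℝ → ℝ be continuous on [t₀, t₀+δ], differentiable on (t₀, t₀+δ) and nonnegative there, and let Ψ, F : ℝ → ℝ be nonnegative and continuous, with Φ' (t) + a·Φ(t) + b·Ψ(t) ≤ F(t) + A·δ·∫_{t₀}^t Φ(s) ds + B·δ·∫_{t₀}^t Ψ(s) ds for all t ∈ (t₀, t₀+δ), and δ·(e^{(a/2)δ} − 1)·A ≤ a²/4 and δ·(e^{(a/2)δ} − 1)·B ≤ a·b/4. Suppose in addition that there is δ₀ < t₀ such that Φ and F are defined, nonnegative and continuous on [δ₀, t₀+δ] and Φ(t) ≤ e^{-(a/2)(t−δ₀)} Φ(δ₀) + ∫_{δ₀}^t e^{-(a/2)(t−s)} F(s) ds for all t ∈ (δ₀, t₀]. Then this last inequality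 persists on the next interval: Φ(t) ≤ e^{-(a/2)(t−δ₀)} Φ(δ₀) + ∫_{δ₀}^t e^{-(a/2)(t−s)} F(s) ds for all t ∈ (t₀, t₀+δ]. -/
open Set MeasureTheory intervalIntegral

/-- The primitive of a function continuous on `[c, d]` is differentiable inside `(c, d)`. -/
theorem hasDerivAt_primitive_of_continuousOn {f : ℝ → ℝ} {c d t : ℝ}
    (hf : ContinuousOn f (Icc c d)) (ht : t ∈ Ioo c d) :
    HasDerivAt (fun u => ∫ s in c..u, f s) (f t) t := by
  have hsub : Icc c t ⊆ Icc c d := Icc_subset_Icc le_rfl ht.2.le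
  refine integral_hasDerivAt_right ((hf.mono hsub).intervalIntegrable_of_Icc ht.1.le) ?_
    (hf.continuousAt (Icc_mem_nhds ht.1 ht.2))
  exact (hf.mono Ioo_subset_Icc_self).stronglyMeasurableAtFilter isOpen_Ioo t ht

theorem continuousOn_primitive_of_continuousOn {f : ℝ → ℝ} {c d : ℝ} (hcd : c ≤ d)
    (hf : ContinuousOn f (Icc c d)) :
    ContinuousOn (fun u => ∫ s in c..u, f s) (Icc c d) := by
  have h := continuousOn_primitive_interval' (μ := volume)
    (hf.intervalIntegrable_of_Icc hcd) left_mem_uIcc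
  rwa [uIcc_of_le hcd] at h

theorem integral_exp_neg_mul_sub (k c t : ℝ) (f : ℝ → ℝ) :
    ∫ s in c..t, Real.exp (-k * (t - s)) * f s =
      Real.exp (-k * t) * ∫ s in c..t, Real.exp (k * s) * f s := by
  rw [← intervalIntegral.integral_const_mul]
  congr 1
  ext s
  rw [← mul_assoc, ← Real.exp_add]
  ring_nf

/-- On an interval of length at most `δ`, exponential weights vary at most by `exp (k * δ)`. -/
theorem exp_mul_integral_le {f : ℝ → ℝ} {k c t δ : ℝ} (hk : 0 ≤ k) (hct : c ≤ t)
    (htδ : t ≤ c + δ) (hf : ContinuousOn f (Icc c t)) (hf0 : ∀ s ∈ Icc c t, 0 ≤ f s) :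
    Real.exp (k * t) * ∫ s in c..t, f s ≤
      Real.exp (k * δ) * ∫ s in c..t, Real.exp (k * s) * f s := by
  rw [← intervalIntegral.integral_const_mul, ← intervalIntegral.integral_const_mul]
  refine integral_mono_on hct
    (ContinuousOn.intervalIntegrable_of_Icc hct (by fun_prop))
    (ContinuousOn.intervalIntegrable_of_Icc hct (by fun_prop)) fun s hs => ?_
  rw [← mul_assoc, ← Real.exp_add]
  refine mul_le_mul_of_nonneg_right (Real.exp_le_exp.2 ?_) (hf0 s hs)
  nlinarith [mul_nonneg hk (show 0 ≤ δ + s - t by linarith [hs.1])]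

/-- The exponentially weighted double integral of a nonnegative function over a triangle of side
at most `δ` is controlled by its weighted single integral. -/
theorem mul_exp_integral_sub_le {f : ℝ → ℝ} {k c t δ M m : ℝ} (hk : 0 < k) (hct : c ≤ t)
    (htδ : t ≤ c + δ) (hf : ContinuousOn f (Icc c t)) (hf0 : ∀ s ∈ Icc c t, 0 ≤ f s)
    (hM : 0 ≤ M) (hMm : M * (Real.exp (k * δ) - 1) ≤ m * k) :
    M * ((Real.exp (k * t) * (∫ s in c..t, f s) -
      ∫ s in c..t, Real.exp (k * s) * f s) / k) ≤ m * ∫ s in c..t, Real.exp (k * s) * f s := by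
  have h := exp_mul_integral_le hk.le hct htδ hf hf0
  have h0 : 0 ≤ ∫ s in c..t, Real.exp (k * s) * f s :=
    integral_nonneg hct fun s hs => mul_nonneg (Real.exp_pos _).le (hf0 s hs)
  rw [mul_div_assoc', div_le_iff₀ hk]
  nlinarith [mul_le_mul_of_nonneg_left h hM, mul_le_mul_of_nonneg_right hMm h0]

/-- The derivative of the exponentially weighted double integral over a triangle, the inner
integration having been carried out. -/
theorem hasDerivAt_exp_integral_sub {f : ℝ → ℝ} {k c d t : ℝ} (hk : k ≠ 0)
    (hf : ContinuousOn f (Icc c d)) (ht : t ∈ Ioo c d) :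
    HasDerivAt (fun u => (Real.exp (k * u) * (∫ s in c..u, f s) -
      ∫ s in c..u, Real.exp (k * s) * f s) / k) (Real.exp (k * t) * ∫ s in c..t, f s) t := by
  have hE : HasDerivAt (fun u => Real.exp (k * u)) (Real.exp (k * t) * (k * 1)) t :=
    ((hasDerivAt_id t).const_mul k).exp
  have hw : ContinuousOn (fun s => Real.exp (k * s) * f s) (Icc c d) := by fun_prop
  refine (((hE.mul (hasDerivAt_primitive_of_continuousOn hf ht)).sub
    (hasDerivAt_primitive_of_continuousOn hw ht)).div_const k).congr_deriv ?_
  field_simp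
  ring

/-- The integrated form of a non-local differential inequality on its own interval. -/
theorem exp_mul_le_of_nonlocal_deriv_le
    {c δ a b A B : ℝ} (hδ : 0 < δ) (ha : 0 < a) (hb : 0 < b) (hA : 0 ≤ A) (hB : 0 ≤ B)
    {Φ Φ' Ψ F : ℝ → ℝ}
    (hΦc : ContinuousOn Φ (Icc c (c + δ))) (hΦnn : ∀ t ∈ Icc c (c + δ), 0 ≤ Φ t)
    (hΦd : ∀ t ∈ Ioo c (c + δ), HasDerivAt Φ (Φ' t) t)
    (hΨc : ContinuousOn Ψ (Icc c (c + δ))) (hΨnn : ∀ t ∈ Icc c (c + δ), 0 ≤ Ψ t)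
    (hFc : ContinuousOn F (Icc c (c + δ)))
    (hineq : ∀ t ∈ Ioo c (c + δ),
      Φ' t + a * Φ t + b * Ψ t ≤
        F t + A * δ * (∫ s in c..t, Φ s) + B * δ * (∫ s in c..t, Ψ s))
    (hδA : δ * (Real.exp ((a / 2) * δ) - 1) * A ≤ a ^ 2 / 4)
    (hδB : δ * (Real.exp ((a / 2) * δ) - 1) * B ≤ a * b / 4)
    {t : ℝ} (ht : t ∈ Icc c (c + δ)) :
    Real.exp (a / 2 * t) * Φ t ≤
      Real.exp (a / 2 * c) * Φ c + ∫ s in c..t, Real.exp (a / 2 * s) * F s := by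
  have hcd : c ≤ c + δ := by linarith
  obtain ⟨k, rfl⟩ : ∃ k, a = 2 * k := ⟨a / 2, by ring⟩
  have hk : 0 < k := by linarith
  rw [show 2 * k / 2 = k by ring] at *
  have hwΦ : ContinuousOn (fun s => Real.exp (k * s) * Φ s) (Icc c (c + δ)) := by fun_prop
  have hwΨ : ContinuousOn (fun s => Real.exp (k * s) * Ψ s) (Icc c (c + δ)) := by fun_prop
  have hwF : ContinuousOn (fun s => Real.exp (k * s) * F s) (Icc c (c + δ)) := by fun_prop
  have hPΦ := continuousOn_primitive_of_continuousOn hcd hΦc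
  have hPΨ := continuousOn_primitive_of_continuousOn hcd hΨc
  have hPwΦ := continuousOn_primitive_of_continuousOn hcd hwΦ
  have hPwΨ := continuousOn_primitive_of_continuousOn hcd hwΨ
  have hPwF := continuousOn_primitive_of_continuousOn hcd hwF
  let G : ℝ → ℝ := fun u => Real.exp (k * u) * Φ u - (∫ s in c..u, Real.exp (k * s) * F s)
    + k * (∫ s in c..u, Real.exp (k * s) * Φ s) + b * (∫ s in c..u, Real.exp (k * s) * Ψ s)
    - A * δ * ((Real.exp (k * u) * (∫ s in c..u, Φ s) -
        ∫ s in c..u, Real.exp (k * s) * Φ s) / k)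
    - B * δ * ((Real.exp (k * u) * (∫ s in c..u, Ψ s) -
        ∫ s in c..u, Real.exp (k * s) * Ψ s) / k)
  have hGc : ContinuousOn G (Icc c (c + δ)) := by
    simp only [G]
    fun_prop
  have hGd : ∀ u ∈ Ioo c (c + δ), HasDerivAt G (Real.exp (k * u) *
      (Φ' u + 2 * k * Φ u + b * Ψ u -
        (F u + A * δ * (∫ s in c..u, Φ s) + B * δ * (∫ s in c..u, Ψ s)))) u := by
    intro u hu
    have hE : HasDerivAt (fun u => Real.exp (k * u)) (Real.exp (k * u) * (k * 1)) u :=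
      ((hasDerivAt_id u).const_mul k).exp
    refine ((((((hE.mul (hΦd u hu)).sub
      (hasDerivAt_primitive_of_continuousOn hwF hu)).add
      ((hasDerivAt_primitive_of_continuousOn hwΦ hu).const_mul k)).add
      ((hasDerivAt_primitive_of_continuousOn hwΨ hu).const_mul b)).sub
      ((hasDerivAt_exp_integral_sub hk.ne' hΦc hu).const_mul (A * δ))).sub
      ((hasDerivAt_exp_integral_sub hk.ne' hΨc hu).const_mul (B * δ))).congr_deriv ?_
    ring
  have hanti : AntitoneOn G (Icc c (c + δ)) := by
    refine antitoneOn_of_deriv_nonpos (convex_Icc _ _) hGc ?_ ?_ <;> rw [interior_Icc]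
    · exact fun u hu => (hGd u hu).differentiableAt.differentiableWithinAt
    · intro u hu
      rw [(hGd u hu).deriv]
      exact mul_nonpos_of_nonneg_of_nonpos (Real.exp_pos _).le (sub_nonpos.2 (hineq u hu))
  have hG := hanti (left_mem_Icc.2 hcd) ht ht.1
  simp only [G, integral_same] at hG
  have hsub : Icc c t ⊆ Icc c (c + δ) := Icc_subset_Icc le_rfl ht.2
  have hΦ := mul_exp_integral_sub_le (M := A * δ) (m := k) hk ht.1 ht.2 (hΦc.mono hsub)
    (fun s hs => hΦnn s (hsub hs)) (by positivity) (by linarith)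
  have hΨ := mul_exp_integral_sub_le (M := B * δ) (m := b) hk ht.1 ht.2 (hΨc.mono hsub)
    (fun s hs => hΨnn s (hsub hs)) (by positivity) (by nlinarith [mul_pos hk hb])
  simp only [mul_zero, sub_zero, zero_div, add_zero] at hG
  linarith

/-- Non-local Gronwall inequality, part (ii): if the exponential-decay bound has been
established up to time `t₀` (starting at `δ₀ < t₀`), then under the non-local
differential inequality and the smallness conditions on `δ`, this bound persists on
the next interval `(t₀, t₀ + δ]`. -/
theorem nonlocal_gronwall_part_ii
    (t₀ δ a b A B δ₀ : ℝ) (hδ : 0 < δ) (ha : 0 < a) (hb : 0 < b)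
    (hA : 0 ≤ A) (hB : 0 ≤ B) (hδ₀ : δ₀ < t₀)
    (Φ Φ' Ψ F : ℝ → ℝ)
    (hΦc : ContinuousOn Φ (Icc δ₀ (t₀ + δ)))
    (hΦnn : ∀ t ∈ Icc δ₀ (t₀ + δ), 0 ≤ Φ t)
    (hΦd : ∀ t ∈ Ioo t₀ (t₀ + δ), HasDerivAt Φ (Φ' t) t)
    (hΨc : ContinuousOn Ψ (Icc t₀ (t₀ + δ)))
    (hΨnn : ∀ t ∈ Icc t₀ (t₀ + δ), 0 ≤ Ψ t)
    (hFc : ContinuousOn F (Icc δ₀ (t₀ + δ)))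
    (hFnn : ∀ t ∈ Icc δ₀ (t₀ + δ), 0 ≤ F t)
    (hineq : ∀ t ∈ Ioo t₀ (t₀ + δ),
      Φ' t + a * Φ t + b * Ψ t ≤
        F t + A * δ * (∫ s in t₀..t, Φ s) + B * δ * (∫ s in t₀..t, Ψ s))
    (hδA : δ * (Real.exp ((a / 2) * δ) - 1) * A ≤ a ^ 2 / 4)
    (hδB : δ * (Real.exp ((a / 2) * δ) - 1) * B ≤ a * b / 4)
    (hpast : ∀ t ∈ Ioc δ₀ t₀,
      Φ t ≤ Real.exp (-(a / 2) * (t - δ₀)) * Φ δ₀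
          + ∫ s in δ₀..t, Real.exp (-(a / 2) * (t - s)) * F s) :
    ∀ t ∈ Ioc t₀ (t₀ + δ),
      Φ t ≤ Real.exp (-(a / 2) * (t - δ₀)) * Φ δ₀
          + ∫ s in δ₀..t, Real.exp (-(a / 2) * (t - s)) * F s := by
  intro t ht
  have hsub : Icc t₀ (t₀ + δ) ⊆ Icc δ₀ (t₀ + δ) := Icc_subset_Icc hδ₀.le le_rfl
  have hnew := exp_mul_le_of_nonlocal_deriv_le hδ ha hb hA hB (hΦc.mono hsub)
    (fun s hs => hΦnn s (hsub hs)) hΦd hΨc hΨnn (hFc.mono hsub) hineq hδA hδB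
    (Ioc_subset_Icc_self ht)
  have hold := hpast t₀ (right_mem_Ioc.2 hδ₀)
  rw [integral_exp_neg_mul_sub] at hold ⊢
  have hw : ContinuousOn (fun s => Real.exp (a / 2 * s) * F s) (Icc δ₀ (t₀ + δ)) := by fun_prop
  have hadd := integral_add_adjacent_intervals (μ := volume)
    ((hw.mono (Icc_subset_Icc le_rfl (by linarith))).intervalIntegrable_of_Icc hδ₀.le)
    ((hw.mono (Icc_subset_Icc hδ₀.le ht.2)).intervalIntegrable_of_Icc ht.1.le)
  have hsplit : ∀ u, Real.exp (-(a / 2) * (u - δ₀)) =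
      Real.exp (-(a / 2) * u) * Real.exp (a / 2 * δ₀) := fun u => by
    rw [← Real.exp_add]
    ring_nf
  have hcancel : ∀ u, Real.exp (-(a / 2) * u) * Real.exp (a / 2 * u) = 1 := fun u => by
    rw [← Real.exp_add]
    simp
  rw [hsplit, mul_assoc, ← mul_add] at hold ⊢
  have hold' := mul_le_mul_of_nonneg_left hold (Real.exp_pos (a / 2 * t₀)).le
  rw [← mul_assoc (Real.exp (a / 2 * t₀)), mul_comm (Real.exp (a / 2 * t₀)) (Real.exp _),
    hcancel, one_mul, mul_comm _ (Φ t₀)] at hold'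
  calc Φ t = Real.exp (-(a / 2) * t) * (Real.exp (a / 2 * t) * Φ t) := by
        rw [← mul_assoc, hcancel, one_mul]
    _ ≤ _ := mul_le_mul_of_nonneg_left (by linarith) (Real.exp_pos _).le
end

section
/- Let β ∈ (0, 2) and let K_β : ℝ² → [0, ∞] be the Riesz kernel K_β(x) := ‖x‖^{β−2} (Euclidean norm). Then K_β is nonnegative and locally integrable on ℝ², and for every integrable φ : ℝ² → ℝ, every finite index set 𝒜 and measurable subsets {A_α}_{α∈𝒜} of ℝ² with bounded overlap N := sup_{x∈ℝ²} #{α ∈ 𝒜 : x ∈ A_α} < ∞, setting φ_α := φ·1_{A_α}, one has ∑_{α∈𝒜} ‖K_β ∗ φ_α‖²_{L²(ℝ²)} ≤ N · ‖K_β ∗ |φ|‖²_{L²(ℝ²)}. -/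
open Set MeasureTheory ENNReal

/-- The lower integral is superadditive over finite sums, with no measurability needed. -/
theorem sum_lintegral_le_lintegral_sum {X ι : Type*} [MeasurableSpace X] (μ : Measure X)
    (s : Finset ι) (f : ι → X → ℝ≥0∞) :
    ∑ i ∈ s, ∫⁻ x, f i x ∂μ ≤ ∫⁻ x, ∑ i ∈ s, f i x ∂μ := by
  classical
  induction s using Finset.induction_on with
  | empty => simp
  | insert i s hi ih =>
    simp only [Finset.sum_insert hi]
    exact (add_le_add_right ih _).trans (le_lintegral_add _ _)

/-- The square-function bound for a nonnegative kernel, with values in `ℝ≥0∞`: restricting `f`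
to sets of overlap at most `N` increases the sum of squares by at most a factor `N`. -/
theorem sum_lintegral_sq_indicator_le {X Y ι : Type*} [MeasurableSpace X] [MeasurableSpace Y]
    [Fintype ι] (μ : Measure X) (ν : Measure Y) (k : X → Y → ℝ≥0∞) (f : Y → ℝ≥0∞)
    (A : ι → Set Y) (N : ℕ) (hN : ∀ y, Nat.card {α : ι // y ∈ A α} ≤ N) :
    ∑ α, ∫⁻ x, (∫⁻ y, k x y * (A α).indicator f y ∂ν) ^ 2 ∂μ ≤
      (N : ℝ≥0∞) * ∫⁻ x, (∫⁻ y, k x y * f y ∂ν) ^ 2 ∂μ := by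
  classical
  have hsum (y : Y) : ∑ α, (A α).indicator f y ≤ N * f y := by
    simp only [indicator_apply, ← Finset.sum_filter, Finset.sum_const, nsmul_eq_mul]
    gcongr
    simpa [Nat.card_eq_fintype_card, Fintype.card_subtype] using hN y
  have hle (α : ι) (x : X) :
      ∫⁻ y, k x y * (A α).indicator f y ∂ν ≤ ∫⁻ y, k x y * f y ∂ν :=
    lintegral_mono fun y => mul_le_mul_right (indicator_le_self' (fun _ _ => zero_le) y) _
  have hlin (x : X) :
      ∑ α, ∫⁻ y, k x y * (A α).indicator f y ∂ν ≤ N * ∫⁻ y, k x y * f y ∂ν := by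
    refine (sum_lintegral_le_lintegral_sum ν _ _).trans ?_
    rw [← lintegral_const_mul' _ _ (natCast_ne_top N)]
    refine lintegral_mono fun y => ?_
    rw [← Finset.mul_sum, mul_left_comm]
    gcongr
    exact hsum y
  refine (sum_lintegral_le_lintegral_sum μ _ _).trans ?_
  rw [← lintegral_const_mul' _ _ (natCast_ne_top N)]
  refine lintegral_mono fun x => ?_
  calc ∑ α, (∫⁻ y, k x y * (A α).indicator f y ∂ν) ^ 2
      ≤ ∑ α, (∫⁻ y, k x y * (A α).indicator f y ∂ν) * ∫⁻ y, k x y * f y ∂ν := by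
        simp only [sq]
        exact Finset.sum_le_sum fun α _ => mul_le_mul_right (hle α x) _
    _ ≤ N * (∫⁻ y, k x y * f y ∂ν) ^ 2 := by
        rw [← Finset.sum_mul, sq, ← mul_assoc]
        gcongr
        exact hlin x

/-- The Riesz kernel `K_β(x) = ‖x‖^(β-2)` on `ℝ²`, for `β ∈ (0,2)`, is nonnegative and
locally integrable, and the convolution square-function bound holds for it: the ℓ² sum
of the squared `L²` norms of `K_β ∗ φ_α` (with `φ_α = φ·1_{A α}`, sets of overlap at
most `N`) is bounded by `N` times the squared `L²` norm of `K_β ∗ |φ|`. -/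
theorem riesz_kernel_square_function_bound
    {ι : Type*} [Fintype ι]
    (β : ℝ) (hβ : β ∈ Ioo (0 : ℝ) 2)
    (φ : EuclideanSpace ℝ (Fin 2) → ℝ) (hφ : Integrable φ)
    (A : ι → Set (EuclideanSpace ℝ (Fin 2))) (hA : ∀ α, MeasurableSet (A α))
    (N : ℕ) (hN : ∀ x, Nat.card {α : ι // x ∈ A α} ≤ N) :
    (∀ x : EuclideanSpace ℝ (Fin 2), 0 ≤ ‖x‖ ^ (β - 2)) ∧
    LocallyIntegrable (fun x : EuclideanSpace ℝ (Fin 2) => ‖x‖ ^ (β - 2)) volume ∧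
    ∑ α : ι,
        (eLpNorm (fun x => ∫ y, ‖x - y‖ ^ (β - 2) * (A α).indicator φ y) 2 volume) ^ 2 ≤
      (N : ℝ≥0∞) *
        ∫⁻ x, (∫⁻ y, ENNReal.ofReal (‖x - y‖ ^ (β - 2)) * ENNReal.ofReal |φ y|) ^ 2 := by
  refine ⟨fun x => by positivity, ?_, ?_⟩
  · refine locallyIntegrable_of_norm_le_rpow (C := 1) (α := 2 - β) (by simp) ?_
      (.of_forall fun x => ?_) (measurable_norm.pow_const _).aestronglyMeasurable
    · simp only [finrank_euclideanSpace, Fintype.card_fin, Nat.cast_ofNat]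
      linarith [hβ.1]
    · rw [one_mul, neg_sub, Real.norm_of_nonneg (by positivity)]
  refine le_trans (Finset.sum_le_sum fun α _ => ?_) (sum_lintegral_sq_indicator_le volume volume
    (fun x y => ENNReal.ofReal (‖x - y‖ ^ (β - 2))) (fun y => ENNReal.ofReal |φ y|) A N hN)
  have hsq := eLpNorm_nnreal_pow_eq_lintegral (μ := volume) (p := 2)
    (f := fun x => ∫ y, ‖x - y‖ ^ (β - 2) * (A α).indicator φ y) two_ne_zero
  simp only [NNReal.coe_ofNat, coe_ofNat, ENNReal.rpow_ofNat] at hsq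
  rw [hsq]
  refine lintegral_mono fun x => ?_
  gcongr
  refine (enorm_integral_le_lintegral_enorm _).trans (lintegral_mono fun y => ?_)
  rw [enorm_mul, Real.enorm_of_nonneg (by positivity), enorm_indicator_eq_indicator_enorm]
  simp only [Real.enorm_eq_ofReal_abs, le_refl]
end
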